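/- For every horizon T ≥ 0, every ω ∈ [0,1], and all subsidies m ≤ m', one has 0 ≤ V_{T,m'}(ω) − V_{T,m}(ω) ≤ ((1 − β^T)/(1 − β))·(m' − m); in particular the finite-horizon value function is nondecreasing and Lipschitz continuous in the subsidy m with Lipschitz constant (1 − β^T)/(1 − β). -/

import Mathlib

/-- One-step belief update without observation: `T(ω) = ω·p11 + (1−ω)·p01`. -/
noncomputable def Tmap (p01 p11 ω : ℝ) : ℝ := ω * p11 + (1 - ω) * p01

/-- Belief update after a failed observation: `φ(ω) = εω/(εω + 1 − ω)`. -/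
noncomputable def phi (ε ω : ℝ) : ℝ := ε * ω / (ε * ω + 1 - ω)

/-- Finite-horizon value function `V_T` of the single-armed bandit with subsidy `m`:
`V_0 ≡ 0` and `V_T(ω) = max{V_T(ω;u=1), V_T(ω;u=0)}`. -/
noncomputable def Vfin (p01 p11 ε β m : ℝ) : ℕ → ℝ → ℝ
  | 0, _ => 0
  | T + 1, ω =>
      max ((1 - ε) * ω + β * ((1 - ε) * ω * Vfin p01 p11 ε β m T p11
            + (1 - (1 - ε) * ω) * Vfin p01 p11 ε β m T (Tmap p01 p11 (phi ε ω))))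
          (m + β * Vfin p01 p11 ε β m T (Tmap p01 p11 ω))


theorem Tmap_mem_Icc {p01 p11 ω : ℝ} (hp01 : p01 ∈ Set.Icc (0:ℝ) 1)
    (hp11 : p11 ∈ Set.Icc (0:ℝ) 1) (hω : ω ∈ Set.Icc (0:ℝ) 1) :
    Tmap p01 p11 ω ∈ Set.Icc (0:ℝ) 1 :=
  convex_Icc (0:ℝ) 1 hp11 hp01 hω.1 (sub_nonneg.2 hω.2) (add_sub_cancel ω 1)

theorem phi_mem_Icc {ε ω : ℝ} (hε : 0 ≤ ε) (hω : ω ∈ Set.Icc (0:ℝ) 1) :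
    phi ε ω ∈ Set.Icc (0:ℝ) 1 := by
  have hnum : 0 ≤ ε * ω := mul_nonneg hε hω.1
  have hle : ε * ω ≤ ε * ω + 1 - ω := by linarith [hω.2]
  exact ⟨div_nonneg hnum (hnum.trans hle), div_le_one_of_le₀ hle (hnum.trans hle)⟩

/-- The finite-horizon value function is nondecreasing and Lipschitz in the
subsidy: for `m ≤ m'`, `0 ≤ V_{T,m'}(ω) − V_{T,m}(ω) ≤ ((1 − β^T)/(1 − β))·(m' − m)`. -/
theorem Vfin_subsidy_monotone_lipschitz (p01 p11 ε β : ℝ)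
    (hp01 : p01 ∈ Set.Ioo (0:ℝ) 1) (hp11 : p11 ∈ Set.Ioo (0:ℝ) 1)
    (hne : p01 ≠ p11) (hε : ε ∈ Set.Ioo (0:ℝ) 1) (hβ : β ∈ Set.Ioo (0:ℝ) 1) :
    ∀ T : ℕ, ∀ ω ∈ Set.Icc (0:ℝ) 1, ∀ m m' : ℝ, m ≤ m' →
      0 ≤ Vfin p01 p11 ε β m' T ω - Vfin p01 p11 ε β m T ω ∧
      Vfin p01 p11 ε β m' T ω - Vfin p01 p11 ε β m T ω
        ≤ ((1 - β ^ T) / (1 - β)) * (m' - m) := by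
  intro T
  induction T with
  | zero => intro ω _ m m' _; simp [Vfin]
  | succ T ih =>
    intro ω hω m m' hm
    have hp01' := Set.Ioo_subset_Icc_self hp01
    have hp11' := Set.Ioo_subset_Icc_self hp11
    obtain ⟨hA, hA'⟩ := ih p11 hp11' m m' hm
    obtain ⟨hB, hB'⟩ := ih _ (Tmap_mem_Icc hp01' hp11' (phi_mem_Icc hε.1.le hω)) m m' hm
    obtain ⟨hC, hC'⟩ := ih _ (Tmap_mem_Icc hp01' hp11' hω) m m' hm
    have hgeom : (1 - β ^ (T + 1)) / (1 - β) = 1 + β * ((1 - β ^ T) / (1 - β)) := by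
      have h : 1 - β ≠ 0 := (sub_pos.2 hβ.2).ne'
      field_simp
      ring
    have hq : 0 ≤ (1 - ε) * ω := mul_nonneg (sub_nonneg.2 hε.2.le) hω.1
    have hq' : 0 ≤ 1 - (1 - ε) * ω := by nlinarith [hω.1, hω.2, hε.1]
    rw [hgeom]
    simp only [Vfin]
    generalize (1 - β ^ T) / (1 - β) = C at *
    generalize (1 - ε) * ω = q at *
    generalize Vfin p01 p11 ε β m T p11 = a at *
    generalize Vfin p01 p11 ε β m' T p11 = a' at *
    generalize Vfin p01 p11 ε β m T (Tmap p01 p11 (phi ε ω)) = b at *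
    generalize Vfin p01 p11 ε β m' T (Tmap p01 p11 (phi ε ω)) = b' at *
    generalize Vfin p01 p11 ε β m T (Tmap p01 p11 ω) = c at *
    generalize Vfin p01 p11 ε β m' T (Tmap p01 p11 ω) = c' at *
    have hβ0 := hβ.1.le
    have hmix : 0 ≤ β * (q * (a' - a) + (1 - q) * (b' - b)) := by positivity
    have hmix' : β * (q * (a' - a) + (1 - q) * (b' - b)) ≤ β * (C * (m' - m)) := by
      refine mul_le_mul_of_nonneg_left ?_ hβ0
      linarith [mul_le_mul_of_nonneg_left hA' hq, mul_le_mul_of_nonneg_left hB' hq']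
    have hpassive : 0 ≤ β * (c' - c) := mul_nonneg hβ0 hC
    have hpassive' := mul_le_mul_of_nonneg_left hC' hβ0
    constructor
    · rw [sub_nonneg]
      exact max_le_max (by linarith) (by linarith)
    · rw [sub_le_iff_le_add]
      refine max_le ?_ ?_
      · linarith [le_max_left (q + β * (q * a + (1 - q) * b)) (m + β * c)]
      · linarith [le_max_right (q + β * (q * a + (1 - q) * b)) (m + β * c)]
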